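/- Fix ρ > 0 and assume d(n) → ∞ and (n − d)/d → ρ. Define g_ρ(r) = (ρ+1)ln(ρ+1) − ρ·ln ρ − r²/2 + ρ·ln Φ(r) for r ∈ ℝ, and set r_ℓ = inf{r ∈ ℝ : g_ρ(r) > 0} and r_u = sup{r ∈ ℝ : g_ρ(r) > 0}; these are real numbers with r_ℓ < r_u. Then for every fixed r ∈ ℝ: F(n,d,−1, r/√d) → ∞ if r > r_ℓ and F(n,d,−1, r/√d) → 0 if r < r_ℓ; and F(n,d, r/√d, 1) → ∞ if r < r_u and F(n,d, r/√d, 1) → 0 if r > r_u. -/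

import Mathlib

open Filter

noncomputable def c1 (d : ℕ) : ℝ :=
  Real.Gamma ((d : ℝ) / 2) / (Real.sqrt Real.pi * Real.Gamma (((d : ℝ) - 1) / 2))

noncomputable def c2 (d : ℕ) : ℝ :=
  Real.Gamma (((d : ℝ) ^ 2 - 2 * (d : ℝ) + 2) / 2) /
    (Real.sqrt Real.pi * Real.Gamma (((d : ℝ) ^ 2 - 2 * (d : ℝ) + 1) / 2))

/-- `II n d a b` is the integral `I(n,d,a,b)` from the paper. -/
noncomputable def II (n d : ℕ) (a b : ℝ) : ℝ :=
  ∫ h in a..b, (1 - h ^ 2) ^ (((d : ℝ) ^ 2 - 2 * (d : ℝ) - 1) / 2) *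
    (c1 d * ∫ s in (-1 : ℝ)..h, (1 - s ^ 2) ^ (((d : ℝ) - 3) / 2)) ^ (n - d)

/-- `FF n d a b` is the expected number of facets with height in `[a,b]`. -/
noncomputable def FF (n d : ℕ) (a b : ℝ) : ℝ :=
  (n.choose d : ℝ) * 2 * c2 d * II n d a b

/-- The standard normal CDF. -/
noncomputable def stdPhi (r : ℝ) : ℝ :=
  (Real.sqrt (2 * Real.pi))⁻¹ * ∫ s in Set.Iic r, Real.exp (-s ^ 2 / 2)

/-- `g_ρ(r) = (ρ+1)ln(ρ+1) - ρ ln ρ - r²/2 + ρ ln Φ(r)`. -/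
noncomputable def grho (ρ r : ℝ) : ℝ :=
  (ρ + 1) * Real.log (ρ + 1) - ρ * Real.log ρ - r ^ 2 / 2 + ρ * Real.log (stdPhi r)

section GaussianCDF

open Real Set MeasureTheory Topology

theorem integrable_exp_neg_sq_div_two : Integrable fun s : ℝ => exp (-s ^ 2 / 2) := by
  convert! integrable_exp_neg_mul_sq (show (0 : ℝ) < 1 / 2 by norm_num) using 3
  ring

theorem integral_exp_neg_sq_div_two : ∫ s : ℝ, exp (-s ^ 2 / 2) = √(2 * π) := by
  rw [show 2 * π = π / (1 / 2) by ring, ← integral_gaussian]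
  congr 1 with s
  congr 1
  ring

theorem stdPhi_pos (r : ℝ) : 0 < stdPhi r := by
  refine mul_pos (by positivity) ?_
  rw [setIntegral_pos_iff_support_of_nonneg_ae (ae_of_all _ fun s => (exp_pos _).le)
    integrable_exp_neg_sq_div_two.integrableOn]
  have : Function.support (fun s : ℝ => exp (-s ^ 2 / 2)) = univ := by
    ext s; simp [(exp_pos _).ne']
  simp [this]

theorem stdPhi_add_tail (r : ℝ) :
    stdPhi r + (√(2 * π))⁻¹ * ∫ s in Ioi r, exp (-s ^ 2 / 2) = 1 := by
  have h := intervalIntegral.integral_Iic_add_Ioi (b := r)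
    integrable_exp_neg_sq_div_two.integrableOn integrable_exp_neg_sq_div_two.integrableOn
  rw [stdPhi, ← mul_add, h, integral_exp_neg_sq_div_two]
  exact inv_mul_cancel₀ (by positivity)

theorem stdPhi_le_one (r : ℝ) : stdPhi r ≤ 1 := by
  have h : 0 ≤ (√(2 * π))⁻¹ * ∫ s in Ioi r, exp (-s ^ 2 / 2) :=
    mul_nonneg (by positivity) (integral_nonneg fun s => (exp_pos _).le)
  linarith [stdPhi_add_tail r]

theorem hasDerivAt_stdPhi (r : ℝ) :
    HasDerivAt stdPhi ((√(2 * π))⁻¹ * exp (-r ^ 2 / 2)) r := by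
  have h : stdPhi = fun x => (√(2 * π))⁻¹ *
      ((∫ s in Iic (0 : ℝ), exp (-s ^ 2 / 2)) + ∫ s in (0 : ℝ)..x, exp (-s ^ 2 / 2)) := by
    ext x
    rw [stdPhi, ← intervalIntegral.integral_Iic_sub_Iic
      integrable_exp_neg_sq_div_two.integrableOn integrable_exp_neg_sq_div_two.integrableOn]
    ring
  rw [h]
  have hc : Continuous fun s : ℝ => exp (-s ^ 2 / 2) := by fun_prop
  exact ((hc.integral_hasStrictDerivAt 0 r).hasDerivAt.const_add _).const_mul _

theorem continuous_stdPhi : Continuous stdPhi :=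
  continuous_iff_continuousAt.2 fun r => (hasDerivAt_stdPhi r).continuousAt

theorem stdPhi_mono : Monotone stdPhi :=
  monotone_of_hasDerivAt_nonneg hasDerivAt_stdPhi fun r => by positivity

theorem stdPhi_zero : stdPhi 0 = 1 / 2 := by
  have h := stdPhi_add_tail 0
  have h2 := integral_comp_neg_Iic (0 : ℝ) fun s => exp (-s ^ 2 / 2)
  simp only [neg_sq, neg_zero] at h2
  rw [← h2] at h
  change stdPhi 0 + stdPhi 0 = 1 at h
  linarith

theorem one_sub_stdPhi_lt {r : ℝ} (hr : 0 ≤ r) : 1 - stdPhi r < exp (-r ^ 2 / 2) := by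
  have htail : ∫ s in Ioi r, exp (-s ^ 2 / 2) =
      ∫ s in Ioi (0 : ℝ), exp (-(s + r) ^ 2 / 2) := by
    rw [← integral_indicator measurableSet_Ioi, ← integral_indicator measurableSet_Ioi,
      ← integral_add_right_eq_self _ r]
    congr 1 with s
    simp [indicator]
  have hle : ∫ s in Ioi (0 : ℝ), exp (-(s + r) ^ 2 / 2) ≤
      exp (-r ^ 2 / 2) * ∫ s in Ioi (0 : ℝ), exp (-s ^ 2 / 2) := by
    rw [← integral_const_mul]
    refine setIntegral_mono_on ?_ ?_ measurableSet_Ioi fun s hs => ?_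
    · exact (integrable_exp_neg_sq_div_two.comp_add_right r).integrableOn
    · exact (integrable_exp_neg_sq_div_two.const_mul _).integrableOn
    · rw [← exp_add]
      refine exp_le_exp.2 ?_
      have : 0 ≤ s * r := mul_nonneg (le_of_lt hs) hr
      nlinarith
  have h0 := stdPhi_add_tail 0
  have h1 := stdPhi_add_tail r
  rw [stdPhi_zero] at h0
  rw [htail] at h1
  have hpos : 0 < (√(2 * π))⁻¹ := by positivity
  have := mul_le_mul_of_nonneg_left hle hpos.le
  have he := exp_pos (-r ^ 2 / 2)
  have h3 : (√(2 * π))⁻¹ * (exp (-r ^ 2 / 2) * ∫ s in Ioi (0 : ℝ), exp (-s ^ 2 / 2)) =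
      exp (-r ^ 2 / 2) * (1 / 2) := by
    rw [mul_left_comm]; congr 1; linarith
  linarith

theorem exists_nonneg_stdPhi_eq {q : ℝ} (hq : 1 / 2 ≤ q) (hq1 : q < 1) :
    ∃ r, 0 ≤ r ∧ stdPhi r = q := by
  have hlim : Tendsto (fun r : ℝ => exp (-r ^ 2 / 2)) atTop (𝓝 0) := by
    refine tendsto_exp_atBot.comp ?_
    have : Tendsto (fun r : ℝ => r ^ 2 / 2) atTop atTop :=
      (tendsto_pow_atTop two_ne_zero).atTop_div_const two_pos
    exact (tendsto_neg_atTop_atBot.comp this).congr fun r => (neg_div _ _).symm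
  obtain ⟨R, hR, hR0⟩ := ((hlim.eventually_lt_const (sub_pos.2 hq1)).and
    (eventually_ge_atTop 0)).exists
  have hRq : q ≤ stdPhi R := by linarith [one_sub_stdPhi_lt hR0]
  obtain ⟨r, hr, hrq⟩ := intermediate_value_Icc hR0 continuous_stdPhi.continuousOn
    (show q ∈ Icc (stdPhi 0) (stdPhi R) from ⟨by rwa [stdPhi_zero], hRq⟩)
  exact ⟨r, hr.1, hrq⟩

end GaussianCDF

section RateFunction

open Real Set Topology

/-- The exponential growth rate per dimension of `(n.choose d)` when `(n - d) / d → ρ`. -/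
noncomputable def chooseRate (ρ : ℝ) : ℝ :=
  (ρ + 1) * log (ρ + 1) - ρ * log ρ

theorem chooseRate_pos {ρ : ℝ} (hρ : 0 < ρ) : 0 < chooseRate ρ := by
  have h1 : 0 < log (ρ + 1) := log_pos (by linarith)
  have h2 : log ρ ≤ log (ρ + 1) := log_le_log hρ (by linarith)
  unfold chooseRate
  nlinarith

theorem grho_eq (ρ r : ℝ) :
    grho ρ r = chooseRate ρ - r ^ 2 / 2 + ρ * log (stdPhi r) := rfl

theorem hasDerivAt_grho (ρ r : ℝ) :
    HasDerivAt (grho ρ)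
      (-r + ρ * ((√(2 * π))⁻¹ * exp (-r ^ 2 / 2) / stdPhi r)) r := by
  have h := (((hasDerivAt_pow 2 r).div_const 2).const_sub (chooseRate ρ)).add
    (((hasDerivAt_stdPhi r).log (stdPhi_pos r).ne').const_mul ρ)
  convert! h using 1
  push_cast
  ring

theorem continuous_grho (ρ : ℝ) : Continuous (grho ρ) :=
  continuous_iff_continuousAt.2 fun r => (hasDerivAt_grho ρ r).continuousAt

theorem min_grho_lt {ρ x y z : ℝ} (hρ : 0 < ρ) (hxy : x < y) (hyz : y < z) :
    min (grho ρ x) (grho ρ z) < grho ρ y := by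
  by_contra! hle
  obtain ⟨hx, hz⟩ := le_min_iff.1 hle
  obtain ⟨a, ha, hfa⟩ := exists_hasDerivAt_eq_slope (grho ρ) _ hxy
    (continuous_grho ρ).continuousOn fun t _ => hasDerivAt_grho ρ t
  obtain ⟨b, hb, hfb⟩ := exists_hasDerivAt_eq_slope (grho ρ) _ hyz
    (continuous_grho ρ).continuousOn fun t _ => hasDerivAt_grho ρ t
  have h1 : (grho ρ y - grho ρ x) / (y - x) ≤ 0 :=
    div_nonpos_of_nonpos_of_nonneg (by linarith) (by linarith)
  have h2 : 0 ≤ (grho ρ z - grho ρ y) / (z - y) := div_nonneg (by linarith) (by linarith)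
  rw [← hfa] at h1
  rw [← hfb] at h2
  have hab : a < b := ha.2.trans hb.1
  have hpa := stdPhi_pos a
  have hpb := stdPhi_pos b
  have hmono := stdPhi_mono hab.le
  have hc : 0 < (√(2 * π))⁻¹ := by positivity
  have ha0 : 0 < a := by
    have : 0 < ρ * ((√(2 * π))⁻¹ * exp (-a ^ 2 / 2) / stdPhi a) := by positivity
    linarith
  have hexp : exp (-b ^ 2 / 2) ≤ exp (-a ^ 2 / 2) := exp_le_exp.2 (by nlinarith)
  have : ρ * ((√(2 * π))⁻¹ * exp (-b ^ 2 / 2) / stdPhi b) ≤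
      ρ * ((√(2 * π))⁻¹ * exp (-a ^ 2 / 2) / stdPhi a) := by gcongr
  linarith

theorem exists_grho_pos {ρ : ℝ} (hρ : 0 < ρ) : ∃ r, 0 < grho ρ r := by
  rcases le_total ρ 1 with h1 | h1
  · refine ⟨0, ?_⟩
    rw [grho_eq, stdPhi_zero, chooseRate, one_div, log_inv]
    have e1 : 0 < log (ρ + 1) := log_pos (by linarith)
    have e2 : log 2 + log ρ ≤ log (ρ + 1) := by
      rw [← log_mul two_ne_zero hρ.ne']
      exact log_le_log (by positivity) (by linarith)
    nlinarith
  · have hlt : ρ / (ρ + 1) < 1 := (div_lt_one (by linarith)).2 (by linarith)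
    obtain ⟨r, hr, hrq⟩ := exists_nonneg_stdPhi_eq (q := ρ / (ρ + 1))
      (by rw [div_le_div_iff₀ two_pos (by linarith)]; linarith) hlt
    refine ⟨r, ?_⟩
    have htail := one_sub_stdPhi_lt hr
    have hq : 1 - ρ / (ρ + 1) = (ρ + 1)⁻¹ := by field_simp; ring
    rw [hrq, hq] at htail
    have hl := log_lt_log (by positivity) htail
    rw [log_exp, log_inv] at hl
    rw [grho_eq, hrq, chooseRate, log_div hρ.ne' (by linarith)]
    linarith

theorem abs_lt_of_grho_pos {ρ r : ℝ} (hρ : 0 < ρ) (h : 0 < grho ρ r) :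
    |r| < 2 * chooseRate ρ + 1 := by
  have hlog : log (stdPhi r) ≤ 0 := log_nonpos (stdPhi_pos r).le (stdPhi_le_one r)
  rw [grho_eq] at h
  have hA := chooseRate_pos hρ
  refine abs_lt_of_sq_lt_sq ?_ (by linarith)
  nlinarith

theorem bddAbove_grho_pos {ρ : ℝ} (hρ : 0 < ρ) : BddAbove {r | 0 < grho ρ r} :=
  ⟨_, fun _ hr => (abs_lt.1 (abs_lt_of_grho_pos hρ hr)).2.le⟩

theorem bddBelow_grho_pos {ρ : ℝ} (hρ : 0 < ρ) : BddBelow {r | 0 < grho ρ r} :=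
  ⟨_, fun _ hr => (abs_lt.1 (abs_lt_of_grho_pos hρ hr)).1.le⟩

theorem sInf_lt_sSup_grho_pos {ρ : ℝ} (hρ : 0 < ρ) :
    sInf {r | 0 < grho ρ r} < sSup {r | 0 < grho ρ r} := by
  obtain ⟨r, hr⟩ := exists_grho_pos hρ
  have hev : ∀ᶠ t in 𝓝[>] r, 0 < grho ρ t :=
    ((continuous_grho ρ).continuousAt.eventually_const_lt hr).filter_mono nhdsWithin_le_nhds
  obtain ⟨t, ht, hrt⟩ := (hev.and self_mem_nhdsWithin).exists
  exact ((csInf_le (bddBelow_grho_pos hρ) hr).trans_lt hrt).trans_le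
    (le_csSup (bddAbove_grho_pos hρ) ht)

theorem grho_neg_of_lt_sInf {ρ r : ℝ} (hρ : 0 < ρ) (hr : r < sInf {r | 0 < grho ρ r}) :
    grho ρ r < 0 ∧ ∀ t ≤ r, grho ρ t ≤ grho ρ r := by
  obtain ⟨s, hs⟩ := exists_grho_pos hρ
  have hnot : ∀ t < sInf {r | 0 < grho ρ r}, grho ρ t ≤ 0 := fun t ht =>
    not_lt.1 fun h => (csInf_le (bddBelow_grho_pos hρ) h).not_gt ht
  have hsle := csInf_le (bddBelow_grho_pos hρ) hs
  have hneg : grho ρ r < 0 := by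
    obtain ⟨t, hrt, ht⟩ := exists_between hr
    have h := min_grho_lt hρ hrt (ht.trans_le hsle)
    rcases min_lt_iff.1 (h.trans_le (hnot t ht)) with h | h
    · exact h
    · exact absurd hs h.le.not_gt
  refine ⟨hneg, fun t ht => ?_⟩
  rcases ht.eq_or_lt with rfl | ht
  · exact le_rfl
  rcases min_lt_iff.1 (min_grho_lt hρ ht (hr.trans_le hsle)) with h | h
  · exact h.le
  · exact absurd (h.trans hneg) (not_lt.2 (le_of_lt hs))

theorem grho_neg_of_sSup_lt {ρ r : ℝ} (hρ : 0 < ρ) (hr : sSup {r | 0 < grho ρ r} < r) :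
    grho ρ r < 0 ∧ ∀ t ≥ r, grho ρ t ≤ grho ρ r := by
  obtain ⟨s, hs⟩ := exists_grho_pos hρ
  have hnot : ∀ t > sSup {r | 0 < grho ρ r}, grho ρ t ≤ 0 := fun t ht =>
    not_lt.1 fun h => (le_csSup (bddAbove_grho_pos hρ) h).not_gt ht
  have hsle := le_csSup (bddAbove_grho_pos hρ) hs
  have hneg : grho ρ r < 0 := by
    obtain ⟨t, ht, htr⟩ := exists_between hr
    have h := min_grho_lt hρ (hsle.trans_lt ht) htr
    rcases min_lt_iff.1 (h.trans_le (hnot t ht)) with h | h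
    · exact absurd hs h.le.not_gt
    · exact h
  refine ⟨hneg, fun t ht => ?_⟩
  rcases (show r ≤ t from ht).eq_or_lt with rfl | ht
  · exact le_rfl
  rcases min_lt_iff.1 (min_grho_lt hρ (hsle.trans_lt hr) ht) with h | h
  · exact absurd (h.trans hneg) (not_lt.2 (le_of_lt hs))
  · exact h.le

end RateFunction

section GammaRatio

open Real

theorem Gamma_add_half_le {x : ℝ} (hx : 0 < x) : Gamma (x + 1 / 2) ≤ √x * Gamma x := by
  have h := Gamma_mul_add_mul_le_rpow_Gamma_mul_rpow_Gamma hx (show 0 < x + 1 by linarith)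
    one_half_pos one_half_pos (add_halves 1)
  rw [show 1 / 2 * x + 1 / 2 * (x + 1) = x + 1 / 2 by ring, Gamma_add_one hx.ne',
    ← sqrt_eq_rpow, ← sqrt_eq_rpow, sqrt_mul hx.le, mul_left_comm,
    mul_self_sqrt (Gamma_pos_of_pos hx).le] at h
  exact h

theorem Gamma_add_half_div_le {x : ℝ} (hx : 0 < x) :
    Gamma (x + 1 / 2) / (√π * Gamma x) ≤ √(x / π) := by
  have hG := Gamma_pos_of_pos hx
  have hpi : 0 < √π := by positivity
  rw [sqrt_div hx.le, div_le_div_iff₀ (by positivity) hpi]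
  nlinarith [Gamma_add_half_le hx]

theorem le_Gamma_add_half_div {x : ℝ} (hx : 1 / 2 < x) :
    √((x - 1 / 2) / π) ≤ Gamma (x + 1 / 2) / (√π * Gamma x) := by
  have hx' : 0 < x - 1 / 2 := by linarith
  have hG := Gamma_pos_of_pos (show 0 < x by linarith)
  have hpi : 0 < √π := by positivity
  have h := Gamma_add_half_le hx'
  rw [sub_add_cancel] at h
  have hs : 0 < √(x - 1 / 2) := sqrt_pos.2 hx'
  have h2 : Gamma (x + 1 / 2) = (x - 1 / 2) * Gamma (x - 1 / 2) := by
    rw [← Gamma_add_one hx'.ne']; ring_nf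
  have h3 : √(x - 1 / 2) * Gamma x ≤ Gamma (x + 1 / 2) := by
    calc √(x - 1 / 2) * Gamma x ≤ √(x - 1 / 2) * (√(x - 1 / 2) * Gamma (x - 1 / 2)) := by gcongr
      _ = Gamma (x + 1 / 2) := by rw [← mul_assoc, mul_self_sqrt hx'.le, h2]
  rw [sqrt_div hx'.le, div_le_div_iff₀ hpi (by positivity)]
  nlinarith

theorem c1_eq (d : ℕ) : c1 d = Gamma (((d : ℝ) - 1) / 2 + 1 / 2) /
    (√π * Gamma (((d : ℝ) - 1) / 2)) := by
  rw [c1]; congr 2; ring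

theorem c1_le {d : ℕ} (hd : 2 ≤ d) : c1 d ≤ √(((d : ℝ) - 1) / (2 * π)) := by
  have hd' : (2 : ℝ) ≤ d := by exact_mod_cast hd
  rw [c1_eq, ← div_div ((d : ℝ) - 1) 2 π]
  exact Gamma_add_half_div_le (by linarith)

theorem le_c1 {d : ℕ} (hd : 3 ≤ d) : √(((d : ℝ) - 2) / (2 * π)) ≤ c1 d := by
  have hd' : (3 : ℝ) ≤ d := by exact_mod_cast hd
  rw [c1_eq, ← div_div, show ((d : ℝ) - 2) / 2 = (d - 1) / 2 - 1 / 2 by ring]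
  exact le_Gamma_add_half_div (by linarith)

theorem c1_nonneg {d : ℕ} (hd : 3 ≤ d) : 0 ≤ c1 d := (sqrt_nonneg _).trans (le_c1 hd)

theorem c2_eq (d : ℕ) : c2 d = Gamma (((d : ℝ) - 1) ^ 2 / 2 + 1 / 2) /
    (√π * Gamma (((d : ℝ) - 1) ^ 2 / 2)) := by
  rw [c2]; congr 2 <;> [skip; congr 1] <;> ring_nf

theorem c2_le {d : ℕ} (hd : 2 ≤ d) : c2 d ≤ d := by
  have hd' : (2 : ℝ) ≤ d := by exact_mod_cast hd
  rw [c2_eq]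
  have h1 : 0 < ((d : ℝ) - 1) := by linarith
  refine (Gamma_add_half_div_le (by positivity)).trans (sqrt_le_iff.2 ⟨by linarith, ?_⟩)
  rw [div_le_iff₀ pi_pos]
  nlinarith [pi_gt_three]

theorem half_le_c2 {d : ℕ} (hd : 4 ≤ d) : 1 / 2 ≤ c2 d := by
  have hd' : (4 : ℝ) ≤ d := by exact_mod_cast hd
  rw [c2_eq]
  refine le_trans (le_sqrt_of_sq_le ?_) (le_Gamma_add_half_div (by nlinarith))
  rw [le_div_iff₀ pi_pos]
  nlinarith [pi_lt_four]

theorem tendsto_c1_div_sqrt :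
    Tendsto (fun d : ℕ => c1 d / √d) atTop (nhds (√(2 * π))⁻¹) := by
  have hlim : ∀ a : ℝ, Tendsto (fun d : ℕ => √(((d : ℝ) - a) / (2 * π)) / √d) atTop
      (nhds (√(2 * π))⁻¹) := by
    intro a
    have h1 : Tendsto (fun d : ℕ => 1 - a * (d : ℝ)⁻¹) atTop (nhds 1) := by
      simpa using (tendsto_inv_atTop_nhds_zero_nat (𝕜 := ℝ)).const_mul a |>.const_sub 1
    have h2 := (h1.div_const (2 * π)).sqrt
    rw [one_div, sqrt_inv] at h2
    refine h2.congr' ?_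
    filter_upwards [eventually_gt_atTop 0] with d hd
    have hd' : (0 : ℝ) < d := by exact_mod_cast hd
    rw [← sqrt_div' _ hd'.le]
    congr 1
    field_simp
  refine tendsto_of_tendsto_of_tendsto_of_le_of_le' (hlim 2) (hlim 1) ?_ ?_
  · filter_upwards [eventually_ge_atTop 3] with d hd
    gcongr
    exact le_c1 hd
  · filter_upwards [eventually_ge_atTop 2] with d hd
    gcongr
    exact c1_le hd

end GammaRatio

section CapProbability

open Real Set MeasureTheory Topology

/-- The distribution function of a coordinate of a uniform random point on the unit sphere
in dimension `d`. -/
noncomputable def capCDF (d : ℕ) (h : ℝ) : ℝ :=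
  c1 d * ∫ s in (-1 : ℝ)..h, (1 - s ^ 2) ^ (((d : ℝ) - 3) / 2)

theorem one_sub_sq_rpow_nonneg {s : ℝ} (hs : s ∈ Icc (-1) 1) (β : ℝ) : 0 ≤ (1 - s ^ 2) ^ β :=
  rpow_nonneg (by nlinarith [hs.1, hs.2]) _

theorem one_sub_sq_rpow_le_exp {s β : ℝ} (hs : s ∈ Icc (-1) 1) (hβ : 0 ≤ β) :
    (1 - s ^ 2) ^ β ≤ exp (-(β * s ^ 2)) := by
  rw [show -(β * s ^ 2) = -s ^ 2 * β by ring, exp_mul]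
  exact rpow_le_rpow (by nlinarith [hs.1, hs.2]) (by linarith [add_one_le_exp (-s ^ 2)]) hβ

theorem continuous_one_sub_sq_rpow {β : ℝ} (hβ : 0 ≤ β) :
    Continuous fun s : ℝ => (1 - s ^ 2) ^ β :=
  (by fun_prop : Continuous fun s : ℝ => 1 - s ^ 2).rpow_const fun _ => Or.inr hβ

theorem continuous_capCDF {d : ℕ} (hd : 3 ≤ d) : Continuous (capCDF d) := by
  have hd' : (3 : ℝ) ≤ d := by exact_mod_cast hd
  have hc := continuous_one_sub_sq_rpow (show 0 ≤ ((d : ℝ) - 3) / 2 by linarith)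
  exact continuous_const.mul (intervalIntegral.continuous_primitive
    (fun a b => hc.intervalIntegrable a b) _)

theorem capCDF_mono {d : ℕ} (hd : 3 ≤ d) {x y : ℝ} (hx : -1 ≤ x) (hxy : x ≤ y) (hy : y ≤ 1) :
    capCDF d x ≤ capCDF d y := by
  have hd' : (3 : ℝ) ≤ d := by exact_mod_cast hd
  have hc := continuous_one_sub_sq_rpow (show 0 ≤ ((d : ℝ) - 3) / 2 by linarith)
  refine mul_le_mul_of_nonneg_left ?_ (c1_nonneg hd)
  refine intervalIntegral.integral_mono_interval le_rfl hx hxy ?_ (hc.intervalIntegrable _ _)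
  filter_upwards [ae_restrict_mem measurableSet_Ioc] with s hs
  exact one_sub_sq_rpow_nonneg ⟨hs.1.le, hs.2.trans hy⟩ _

theorem capCDF_nonneg {d : ℕ} (hd : 3 ≤ d) {x : ℝ} (hx : x ∈ Icc (-1) 1) : 0 ≤ capCDF d x := by
  simpa [capCDF] using capCDF_mono hd le_rfl hx.1 hx.2

theorem setIntegral_Iic_exp_mul {m : ℝ} (hm : 0 < m) (x : ℝ) :
    ∫ s in Iic x, exp (-(m * s ^ 2 / 2)) = √(2 * π) / √m * stdPhi (x * √m) := by
  have hsm : 0 < √m := sqrt_pos.2 hm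
  have h1 := integral_comp_neg_Iic x fun s => exp (-(√m * s) ^ 2 / 2)
  have h2 := integral_comp_neg_Iic (x * √m) fun s => exp (-s ^ 2 / 2)
  rw [integral_comp_mul_left_Ioi (fun s => exp (-s ^ 2 / 2)) _ hsm, mul_neg, mul_comm √m x,
    ← h2, smul_eq_mul] at h1
  simp only [neg_sq, mul_pow, sq_sqrt hm.le] at h1
  have hpi : √(2 * π) ≠ 0 := by positivity
  calc ∫ s in Iic x, exp (-(m * s ^ 2 / 2)) = ∫ s in Iic x, exp (-(m * s ^ 2) / 2) := by
        simp only [neg_div]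
    _ = (√m)⁻¹ * ∫ s in Iic (x * √m), exp (-s ^ 2 / 2) := h1
    _ = √(2 * π) / √m * stdPhi (x * √m) := by rw [stdPhi]; field_simp

theorem capCDF_le {d : ℕ} (hd : 4 ≤ d) {h : ℝ} (hh : h ∈ Icc (-1) 1) :
    capCDF d h ≤ exp (1 / ((d : ℝ) - 3)) * stdPhi (h * √((d : ℝ) - 3)) := by
  have hd' : (4 : ℝ) ≤ d := by exact_mod_cast hd
  have hm : 0 < (d : ℝ) - 3 := by linarith
  set m := (d : ℝ) - 3 with hmdef
  have hc := continuous_one_sub_sq_rpow (show 0 ≤ m / 2 by linarith)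
  have hint : Integrable fun s : ℝ => exp (-(m * s ^ 2 / 2)) := by
    convert! integrable_exp_neg_mul_sq (half_pos hm) using 3
    ring
  have h1 : ∫ s in (-1 : ℝ)..h, (1 - s ^ 2) ^ (m / 2) ≤
      ∫ s in Iic h, exp (-(m * s ^ 2 / 2)) := by
    rw [intervalIntegral.integral_of_le hh.1]
    refine (setIntegral_mono_on (hc.intervalIntegrable (-1) h).1 hint.integrableOn
      measurableSet_Ioc fun s hs => ?_).trans
      (setIntegral_mono_set hint.integrableOn (ae_of_all _ fun s => (exp_pos _).le)
        Ioc_subset_Iic_self.eventuallyLE)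
    convert! one_sub_sq_rpow_le_exp (β := m / 2) ⟨hs.1.le, hs.2.trans hh.2⟩ (by positivity) using 2
    ring
  have h2 : c1 d * (√(2 * π) / √m) ≤ exp (1 / m) := by
    calc c1 d * (√(2 * π) / √m)
        ≤ √(((d : ℝ) - 1) / (2 * π)) * (√(2 * π) / √m) := by
          gcongr
          exact c1_le (by omega)
      _ = √(1 + 2 / m) := by
          rw [← sqrt_div (by positivity), ← sqrt_mul (div_nonneg (by linarith) (by positivity))]
          congr 1
          have : (d : ℝ) - 1 = m + 2 := by rw [hmdef]; ring
          rw [this]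
          field_simp
      _ ≤ √(exp (1 / m) ^ 2) := by
          refine sqrt_le_sqrt ?_
          rw [← exp_nat_mul, show ((2 : ℕ) : ℝ) * (1 / m) = 2 / m by push_cast; ring]
          linarith [add_one_le_exp (2 / m)]
      _ = exp (1 / m) := sqrt_sq (exp_pos _).le
  calc capCDF d h ≤ c1 d * ∫ s in Iic h, exp (-(m * s ^ 2 / 2)) :=
        mul_le_mul_of_nonneg_left h1 (c1_nonneg (by omega))
    _ = c1 d * (√(2 * π) / √m) * stdPhi (h * √m) := by
        rw [setIntegral_Iic_exp_mul hm, mul_assoc]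
    _ ≤ exp (1 / m) * stdPhi (h * √m) := mul_le_mul_of_nonneg_right h2 (stdPhi_pos _).le

theorem tendsto_one_sub_sq_div_rpow (t : ℝ) :
    Tendsto (fun d : ℕ => (1 - t ^ 2 / d) ^ (((d : ℝ) - 3) / 2)) atTop
      (𝓝 (exp (-t ^ 2 / 2))) := by
  have h1 := (tendsto_one_add_div_rpow_exp (-t ^ 2)).comp tendsto_natCast_atTop_atTop
  have h2 : Tendsto (fun d : ℕ => (1 - 3 * (d : ℝ)⁻¹) / 2) atTop (𝓝 (1 / 2)) := by
    simpa using ((tendsto_inv_atTop_nhds_zero_nat (𝕜 := ℝ)).const_mul 3 |>.const_sub 1).div_const 2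
  have h3 := h1.rpow h2 (Or.inl (exp_pos _).ne')
  rw [← exp_mul, mul_one_div] at h3
  refine h3.congr' ?_
  filter_upwards [eventually_gt_atTop 0,
    tendsto_natCast_atTop_atTop.eventually_ge_atTop (t ^ 2)] with d hd hdt
  have hd' : (0 : ℝ) < d := by exact_mod_cast hd
  have hnn : 0 ≤ 1 + -t ^ 2 / (d : ℝ) := by
    rw [neg_div]; linarith [(div_le_one hd').2 hdt]
  simp only [Function.comp]
  rw [← rpow_mul hnn, neg_div, ← sub_eq_add_neg]
  congr 1
  field_simp

theorem tendsto_capCDF (x : ℝ) :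
    Tendsto (fun d : ℕ => capCDF d (x / √d)) atTop (𝓝 (stdPhi x)) := by
  have hlim : Tendsto (fun d : ℕ => ∫ t in Iic x,
      (Ioi (-√d)).indicator (fun t : ℝ => (1 - t ^ 2 / d) ^ (((d : ℝ) - 3) / 2)) t) atTop
      (𝓝 (∫ t in Iic x, exp (-t ^ 2 / 2))) := by
    refine tendsto_integral_filter_of_dominated_convergence
      (fun t => exp (-(1 / 8) * t ^ 2)) ?_ ?_
      (integrable_exp_neg_mul_sq (by norm_num)).integrableOn ?_
    · exact Eventually.of_forall fun d =>
        ((by fun_prop : Measurable fun t : ℝ =>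
          (1 - t ^ 2 / d) ^ (((d : ℝ) - 3) / 2)).indicator measurableSet_Ioi).aestronglyMeasurable
    · filter_upwards [eventually_ge_atTop 4,
        tendsto_natCast_atTop_atTop.eventually_ge_atTop (x ^ 2)] with d hd hdx
      have hd' : (4 : ℝ) ≤ d := by exact_mod_cast hd
      have hs : 0 < √(d : ℝ) := sqrt_pos.2 (by linarith)
      filter_upwards [ae_restrict_mem measurableSet_Iic] with t ht
      by_cases hmem : t ∈ Ioi (-√(d : ℝ))
      · rw [indicator_of_mem hmem]
        have hxs : x ≤ √d := le_sqrt_of_sq_le hdx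
        have htd : t / √d ∈ Icc (-1 : ℝ) 1 := by
          constructor
          · rw [le_div_iff₀ hs]; linarith [show -√(d : ℝ) < t from hmem]
          · rw [div_le_one hs]; exact le_trans ht hxs
        have hsq : (t / √d) ^ 2 = t ^ 2 / d := by rw [div_pow, sq_sqrt (by linarith)]
        have hβ : 0 ≤ ((d : ℝ) - 3) / 2 := by linarith
        have h1 := one_sub_sq_rpow_nonneg htd (((d : ℝ) - 3) / 2)
        have h2 := one_sub_sq_rpow_le_exp htd hβ
        rw [hsq] at h1 h2
        rw [norm_of_nonneg h1]
        refine h2.trans (exp_le_exp.2 ?_)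
        have h3 : 1 / 8 ≤ ((d : ℝ) - 3) / 2 / d := by
          rw [le_div_iff₀ (by linarith)]; linarith
        have h4 := mul_le_mul_of_nonneg_right h3 (sq_nonneg t)
        have h5 : ((d : ℝ) - 3) / 2 * (t ^ 2 / d) = ((d : ℝ) - 3) / 2 / d * t ^ 2 := by ring
        linarith
      · rw [indicator_of_notMem hmem, norm_zero]
        exact (exp_pos _).le
    · refine ae_of_all _ fun t => (tendsto_one_sub_sq_div_rpow t).congr' ?_
      have h := (tendsto_sqrt_atTop.comp (tendsto_natCast_atTop_atTop (R := ℝ))).eventually_gt_atTop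
        (-t)
      filter_upwards [h] with d hdt
      rw [indicator_of_mem]
      exact neg_lt.1 hdt
  have hprod := tendsto_c1_div_sqrt.mul hlim
  refine hprod.congr' ?_
  filter_upwards [eventually_ge_atTop 4,
    tendsto_natCast_atTop_atTop.eventually_ge_atTop (x ^ 2)] with d hd hdx
  have hd' : (4 : ℝ) ≤ d := by exact_mod_cast hd
  have hs : 0 < √(d : ℝ) := sqrt_pos.2 (by linarith)
  have hxs : -√d ≤ x := by
    have := abs_le_sqrt hdx
    exact (abs_le.1 this).1
  rw [setIntegral_indicator measurableSet_Ioi, inter_comm, Ioi_inter_Iic,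
    ← intervalIntegral.integral_of_le hxs, capCDF]
  have h := intervalIntegral.integral_comp_div (a := -√d) (b := x)
    (fun s : ℝ => (1 - s ^ 2) ^ (((d : ℝ) - 3) / 2)) hs.ne'
  rw [neg_div, div_self hs.ne', smul_eq_mul] at h
  simp only [div_pow, sq_sqrt (show (0 : ℝ) ≤ d by linarith)] at h
  rw [h]
  field_simp

end CapProbability

section ChooseBounds

open Real

theorem log_factorial_le {n : ℕ} (hn : n ≠ 0) :
    log (n.factorial : ℝ) ≤ n * log n - n + log n / 2 + 1 := by
  obtain ⟨k, rfl⟩ := Nat.exists_eq_succ_of_ne_zero hn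
  have h : log (Stirling.stirlingSeq (k + 1)) ≤ log (Stirling.stirlingSeq (0 + 1)) :=
    Stirling.log_stirlingSeq'_antitone (Nat.zero_le k)
  have hk : ((k + 1 : ℕ) : ℝ) ≠ 0 := by positivity
  rw [zero_add, Stirling.stirlingSeq_one, Stirling.log_stirlingSeq_formula,
    log_div (exp_pos _).ne' (by positivity), log_exp, log_sqrt two_pos.le,
    log_mul two_ne_zero hk, log_div hk (exp_pos _).ne', log_exp] at h
  rw [Nat.succ_eq_add_one]
  linarith

theorem le_log_choose {n d : ℕ} (hd : d ≠ 0) (hdn : d < n) :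
    (n : ℝ) * log n - d * log d - (n - d) * log (n - d) - 2 - (log d + log ((n : ℝ) - d)) / 2 ≤
      log (n.choose d : ℝ) := by
  have hn : n ≠ 0 := by omega
  have h1 := Stirling.le_log_factorial_stirling hn
  have h2 := log_factorial_le hd
  have h3 := log_factorial_le (Nat.sub_ne_zero_of_lt hdn)
  rw [Nat.cast_sub hdn.le] at h3
  have h4 : 0 ≤ log (2 * π) := log_nonneg (by linarith [pi_gt_three])
  have h5 : 0 ≤ log (n : ℝ) := log_natCast_nonneg n
  rw [Nat.cast_choose ℝ hdn.le, log_div (by positivity) (by positivity),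
    log_mul (by positivity) (by positivity)]
  linarith

theorem choose_le_exp {ρ : ℝ} (hρ : 0 < ρ) {n d : ℕ} (hdn : d ≤ n) :
    (n.choose d : ℝ) ≤ exp (n * log (ρ + 1) - (n - d) * log ρ) := by
  have hb : (n.choose d : ℝ) * ρ ^ (n - d) ≤ (ρ + 1) ^ n := by
    rw [add_comm ρ, add_pow]
    refine le_trans (le_of_eq ?_) (Finset.single_le_sum
      (f := fun m => (1 : ℝ) ^ m * ρ ^ (n - m) * (n.choose m : ℝ))
      (fun i _ => by positivity) (Finset.mem_range.2 (Nat.lt_succ_of_le hdn)))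
    simp [mul_comm]
  rw [exp_sub, le_div_iff₀ (exp_pos _), ← Nat.cast_sub hdn, mul_comm (n : ℝ),
    mul_comm ((n - d : ℕ) : ℝ), exp_mul, exp_mul, exp_log hρ, exp_log (by linarith),
    rpow_natCast, rpow_natCast]
  exact hb

end ChooseBounds

section FacetCountBounds

open Real Set MeasureTheory Topology

theorem facet_exponent_nonneg {d : ℕ} (hd : 4 ≤ d) :
    0 ≤ ((d : ℝ) ^ 2 - 2 * d - 1) / 2 := by
  have hd' : (4 : ℝ) ≤ d := by exact_mod_cast hd
  nlinarith

theorem continuous_facet_density (n : ℕ) {d : ℕ} (hd : 4 ≤ d) :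
    Continuous fun h : ℝ =>
      (1 - h ^ 2) ^ (((d : ℝ) ^ 2 - 2 * d - 1) / 2) * capCDF d h ^ (n - d) :=
  (continuous_one_sub_sq_rpow (facet_exponent_nonneg hd)).mul
    ((continuous_capCDF (by omega)).pow _)

theorem facet_density_nonneg (n : ℕ) {d : ℕ} (hd : 4 ≤ d) {h : ℝ} (hh : h ∈ Icc (-1) 1) :
    0 ≤ (1 - h ^ 2) ^ (((d : ℝ) ^ 2 - 2 * d - 1) / 2) * capCDF d h ^ (n - d) :=
  mul_nonneg (one_sub_sq_rpow_nonneg hh _) (pow_nonneg (capCDF_nonneg (by omega) hh) _)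

theorem FF_nonneg (n : ℕ) {d : ℕ} (hd : 4 ≤ d) {a b : ℝ} (ha : -1 ≤ a) (hab : a ≤ b)
    (hb : b ≤ 1) : 0 ≤ FF n d a b := by
  have hc := half_le_c2 hd
  have hI : 0 ≤ II n d a b := intervalIntegral.integral_nonneg hab fun h hh =>
    facet_density_nonneg n hd ⟨ha.trans hh.1, hh.2.trans hb⟩
  exact mul_nonneg (mul_nonneg (by positivity) (by linarith)) hI

theorem facet_density_le {ρ σ γ : ℝ} {n d : ℕ} (hd : 4 ≤ d) (hdn : d < n)
    (hσ0 : 0 ≤ σ) (hσ1 : σ ≤ 1) (hσ : σ * ρ * ((d : ℝ) - 3) ≤ (n : ℝ) - d) {h : ℝ}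
    (hh : h ∈ Icc (-1) 1) (hg : grho ρ (h * √((d : ℝ) - 3)) ≤ γ) :
    (1 - h ^ 2) ^ (((d : ℝ) ^ 2 - 2 * d - 1) / 2) * capCDF d h ^ (n - d) ≤
      exp (((n : ℝ) - d) / ((d : ℝ) - 3) + σ * ((d : ℝ) - 3) * (γ - chooseRate ρ)) := by
  have hd' : (4 : ℝ) ≤ d := by exact_mod_cast hd
  set m := (d : ℝ) - 3 with hm
  have hm1 : 1 ≤ m := by linarith
  set u := h * √m with hu
  have husq : u ^ 2 = h ^ 2 * m := by rw [hu, mul_pow, sq_sqrt (by linarith)]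
  have hk : ((n - d : ℕ) : ℝ) = n - d := Nat.cast_sub hdn.le
  have hΦ := stdPhi_pos u
  have hlog : log (stdPhi u) ≤ 0 := log_nonpos hΦ.le (stdPhi_le_one u)
  have h1 : (1 - h ^ 2) ^ (((d : ℝ) ^ 2 - 2 * d - 1) / 2) ≤ exp (-(m * u ^ 2 / 2)) := by
    refine (one_sub_sq_rpow_le_exp hh (facet_exponent_nonneg hd)).trans (exp_le_exp.2 ?_)
    rw [husq]
    have : m * m / 2 ≤ ((d : ℝ) ^ 2 - 2 * d - 1) / 2 := by rw [hm]; nlinarith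
    nlinarith [sq_nonneg h]
  have h2 : capCDF d h ^ (n - d) ≤
      exp (((n : ℝ) - d) / m + ((n : ℝ) - d) * log (stdPhi u)) := by
    refine (pow_le_pow_left₀ (capCDF_nonneg (by omega) hh) (capCDF_le hd hh) _).trans ?_
    rw [← exp_log hΦ, ← exp_add, ← exp_nat_mul, hk, log_exp]
    exact exp_le_exp.2 (le_of_eq (by ring))
  refine (mul_le_mul h1 h2 (pow_nonneg (capCDF_nonneg (by omega) hh) _) (exp_pos _).le).trans ?_
  rw [← exp_add]
  refine exp_le_exp.2 ?_
  have h3 : ((n : ℝ) - d) * log (stdPhi u) ≤ σ * ρ * m * log (stdPhi u) :=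
    mul_le_mul_of_nonpos_right hσ hlog
  have h4 : σ * (m * u ^ 2 / 2) ≤ m * u ^ 2 / 2 :=
    mul_le_of_le_one_left (by positivity) hσ1
  have h5 : σ * m * (-(u ^ 2 / 2) + ρ * log (stdPhi u)) ≤ σ * m * (γ - chooseRate ρ) := by
    refine mul_le_mul_of_nonneg_left ?_ (by positivity)
    rw [grho_eq] at hg
    linarith
  nlinarith

theorem FF_le {ρ σ γ : ℝ} (hρ : 0 < ρ) {n d : ℕ} (hd : 4 ≤ d) (hdn : d < n)
    (hσ0 : 0 ≤ σ) (hσ1 : σ ≤ 1) (hσ : σ * ρ * ((d : ℝ) - 3) ≤ (n : ℝ) - d) {a b : ℝ}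
    (ha : -1 ≤ a) (hab : a ≤ b) (hb : b ≤ 1)
    (hg : ∀ h ∈ Icc a b, grho ρ (h * √((d : ℝ) - 3)) ≤ γ) :
    FF n d a b ≤ exp (n * log (ρ + 1) - (n - d) * log ρ + (((n : ℝ) - d) / ((d : ℝ) - 3) +
      σ * ((d : ℝ) - 3) * (γ - chooseRate ρ)) + (log 4 + log d)) := by
  have hd' : (4 : ℝ) ≤ d := by exact_mod_cast hd
  set B := ((n : ℝ) - d) / ((d : ℝ) - 3) + σ * ((d : ℝ) - 3) * (γ - chooseRate ρ)
  have hI : II n d a b ≤ 2 * exp B := by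
    calc II n d a b ≤ ∫ _ in a..b, exp B :=
          intervalIntegral.integral_mono_on hab
            ((continuous_facet_density n hd).intervalIntegrable _ _)
            (continuous_const.intervalIntegrable _ _) fun h hh =>
            facet_density_le hd hdn hσ0 hσ1 hσ ⟨ha.trans hh.1, hh.2.trans hb⟩ (hg h hh)
      _ = (b - a) * exp B := by simp
      _ ≤ 2 * exp B := by gcongr; linarith
  have hI0 : 0 ≤ II n d a b := intervalIntegral.integral_nonneg hab fun h hh =>
    facet_density_nonneg n hd ⟨ha.trans hh.1, hh.2.trans hb⟩
  have hc := c2_le (d := d) (by omega)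
  have hc0 := half_le_c2 hd
  calc FF n d a b = (n.choose d : ℝ) * 2 * c2 d * II n d a b := rfl
    _ ≤ exp (n * log (ρ + 1) - (n - d) * log ρ) * 2 * d * (2 * exp B) := by
        gcongr
        exact choose_le_exp hρ hdn.le
    _ = _ := by
        clear_value B
        rw [exp_add, exp_add _ B, exp_add (log 4), exp_log (by norm_num), exp_log (by linarith)]
        ring

theorem le_FF {n d : ℕ} (hd : 4 ≤ d) {x ε a b : ℝ} (hε : 0 < ε) (ha : -1 ≤ a)
    (hax : a ≤ x / √d) (hxb : (x + ε) / √d ≤ b) (hb : b ≤ 1) (hw : (|x| + ε) ^ 2 < d)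
    (hdn : d < n) (hP : 0 < capCDF d (x / √d)) :
    exp (log (n.choose d : ℝ) + (log ε - log d / 2) +
      ((d : ℝ) ^ 2 - 2 * d - 1) / 2 * log (1 - (|x| + ε) ^ 2 / d) +
      ((n : ℝ) - d) * log (capCDF d (x / √d))) ≤ FF n d a b := by
  have hd' : (4 : ℝ) ≤ d := by exact_mod_cast hd
  have hd0 : (0 : ℝ) < d := by linarith
  have hs : 0 < √(d : ℝ) := sqrt_pos.2 hd0
  have hch : (0 : ℝ) < n.choose d := by exact_mod_cast Nat.choose_pos hdn.le
  have hw1 : 0 < 1 - (|x| + ε) ^ 2 / d := sub_pos.2 ((div_lt_one hd0).2 hw)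
  set α := ((d : ℝ) ^ 2 - 2 * d - 1) / 2
  set P := capCDF d (x / √d)
  have hk : ((n - d : ℕ) : ℝ) = n - d := Nat.cast_sub hdn.le
  have hxx : x / √d ≤ (x + ε) / √d := by gcongr; linarith
  have hI : ε / √d * ((1 - (|x| + ε) ^ 2 / d) ^ α * P ^ (n - d)) ≤ II n d a b := by
    calc ε / √d * ((1 - (|x| + ε) ^ 2 / d) ^ α * P ^ (n - d))
        = ∫ _ in (x / √d)..((x + ε) / √d), (1 - (|x| + ε) ^ 2 / d) ^ α * P ^ (n - d) := by
          rw [intervalIntegral.integral_const, smul_eq_mul]; ring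
      _ ≤ ∫ h in (x / √d)..((x + ε) / √d), (1 - h ^ 2) ^ α * capCDF d h ^ (n - d) := by
          refine intervalIntegral.integral_mono_on hxx (continuous_const.intervalIntegrable _ _)
            ((continuous_facet_density n hd).intervalIntegrable _ _) fun h hh => ?_
          have hh1 : h ≤ 1 := hh.2.trans (hxb.trans hb)
          have hh0 : -1 ≤ h := (ha.trans hax).trans hh.1
          have hsq : h ^ 2 ≤ (|x| + ε) ^ 2 / d := by
            have h1 : |h| ≤ (|x| + ε) / √d := by
              refine abs_le.2 ⟨le_trans ?_ hh.1, hh.2.trans ?_⟩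
              · rw [← neg_div]; gcongr; linarith [neg_abs_le x]
              · gcongr; exact le_abs_self x
            have h2 := pow_le_pow_left₀ (abs_nonneg h) h1 2
            rwa [sq_abs, div_pow, sq_sqrt hd0.le] at h2
          refine mul_le_mul (rpow_le_rpow hw1.le (by linarith) (facet_exponent_nonneg hd))
            (pow_le_pow_left₀ hP.le
              (capCDF_mono (by omega) (ha.trans hax) hh.1 hh1) _) (pow_nonneg hP.le _)
            (one_sub_sq_rpow_nonneg ⟨hh0, hh1⟩ _)
      _ ≤ II n d a b := by
          refine intervalIntegral.integral_mono_interval hax hxx hxb ?_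
            ((continuous_facet_density n hd).intervalIntegrable _ _)
          filter_upwards [ae_restrict_mem measurableSet_Ioc] with h hh
          exact facet_density_nonneg n hd ⟨ha.trans hh.1.le, hh.2.trans hb⟩
  have hI0 : 0 ≤ ε / √d * ((1 - (|x| + ε) ^ 2 / d) ^ α * P ^ (n - d)) := by positivity
  have he : exp (log d / 2) = √d := by
    rw [← log_sqrt hd0.le, exp_log hs]
  rw [exp_add, exp_add, exp_add, exp_log hch, exp_sub, exp_log hε, he, mul_comm α,
    ← rpow_def_of_pos hw1, ← hk, exp_nat_mul, exp_log hP]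
  have hc := half_le_c2 hd
  have hc0 : 0 < c2 d := by linarith
  calc (n.choose d : ℝ) * (ε / √d) * (1 - (|x| + ε) ^ 2 / d) ^ α * P ^ (n - d)
      = n.choose d * 1 * (ε / √d * ((1 - (|x| + ε) ^ 2 / d) ^ α * P ^ (n - d))) := by ring
    _ ≤ n.choose d * (2 * c2 d) * II n d a b := by
        gcongr
        linarith
    _ = FF n d a b := by rw [FF]; ring

end FacetCountBounds

section LinearRegime

open Real Set Topology

variable {d : ℕ → ℕ} {ρ : ℝ}

theorem tendsto_ambient_ratio (hdi : Tendsto (fun n : ℕ => (d n : ℝ)) atTop atTop)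
    (hreg : Tendsto (fun n : ℕ => ((n : ℝ) - (d n : ℝ)) / (d n : ℝ)) atTop (𝓝 ρ)) :
    Tendsto (fun n : ℕ => (n : ℝ) / d n) atTop (𝓝 (ρ + 1)) := by
  refine (hreg.add_const 1).congr' ?_
  filter_upwards [hdi.eventually_gt_atTop 0] with n hn
  field_simp
  ring

theorem tendsto_codim_sub_ratio (hdi : Tendsto (fun n : ℕ => (d n : ℝ)) atTop atTop) (a : ℝ) :
    Tendsto (fun n : ℕ => ((d n : ℝ) - a) / d n) atTop (𝓝 1) := by
  have h := (hdi.inv_tendsto_atTop.const_mul a).const_sub 1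
  rw [mul_zero, sub_zero] at h
  refine h.congr' ?_
  filter_upwards [hdi.eventually_gt_atTop 0] with n hn
  simp only [Pi.inv_apply]
  field_simp

theorem tendsto_log_div (hdi : Tendsto (fun n : ℕ => (d n : ℝ)) atTop atTop) :
    Tendsto (fun n : ℕ => log (d n) / d n) atTop (𝓝 0) :=
  (isLittleO_log_id_atTop.tendsto_div_nhds_zero).comp hdi

theorem tendsto_div_sqrt_mul_sqrt (hdi : Tendsto (fun n : ℕ => (d n : ℝ)) atTop atTop) (r : ℝ) :
    Tendsto (fun n : ℕ => r / √(d n) * √((d n : ℝ) - 3)) atTop (𝓝 r) := by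
  have h := ((tendsto_codim_sub_ratio hdi 3).sqrt).const_mul r
  rw [sqrt_one, mul_one] at h
  refine h.congr fun n => ?_
  rw [sqrt_div' _ (Nat.cast_nonneg _)]
  ring

theorem eventually_div_sqrt_mem (hdi : Tendsto (fun n : ℕ => (d n : ℝ)) atTop atTop) (r : ℝ) :
    ∀ᶠ n in atTop, -1 ≤ r / √(d n) ∧ r / √(d n) ≤ 1 := by
  have h : Tendsto (fun n : ℕ => r / √(d n)) atTop (𝓝 0) :=
    tendsto_const_nhds.div_atTop (tendsto_sqrt_atTop.comp hdi)
  exact (h.eventually_const_le (by norm_num)).and (h.eventually_le_const (by norm_num))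

theorem tendsto_FF_zero (hρ : 0 < ρ) (hd : ∀ᶠ n in atTop, 2 ≤ d n ∧ d n < n)
    (hdi : Tendsto (fun n : ℕ => (d n : ℝ)) atTop atTop)
    (hreg : Tendsto (fun n : ℕ => ((n : ℝ) - (d n : ℝ)) / (d n : ℝ)) atTop (𝓝 ρ))
    {γ : ℝ} (hγ : γ < 0) {a b : ℕ → ℝ}
    (hab : ∀ᶠ n in atTop, -1 ≤ a n ∧ a n ≤ b n ∧ b n ≤ 1 ∧
      ∀ h ∈ Icc (a n) (b n), grho ρ (h * √((d n : ℝ) - 3)) ≤ γ) :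
    Tendsto (fun n => FF n (d n) (a n) (b n)) atTop (𝓝 0) := by
  have hA := chooseRate_pos hρ
  obtain ⟨σ, hσ0, hσ1, hσ⟩ : ∃ σ : ℝ, 0 < σ ∧ σ < 1 ∧
      chooseRate ρ + σ * (γ - chooseRate ρ) < 0 := by
    refine ⟨(chooseRate ρ - γ / 2) / (chooseRate ρ - γ), by apply div_pos <;> linarith, ?_, ?_⟩
    · rw [div_lt_one (by linarith)]; linarith
    · rw [← neg_sub (chooseRate ρ) γ, mul_neg, div_mul_cancel₀ _ (by linarith)]; linarith
  have hd4 : ∀ᶠ n in atTop, 4 ≤ d n :=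
    (hdi.eventually_ge_atTop 4).mono fun n hn => by exact_mod_cast hn
  have hm := tendsto_codim_sub_ratio hdi 3
  have hk : Tendsto (fun n : ℕ => ((n : ℝ) - d n) / ((d n : ℝ) - 3)) atTop (𝓝 ρ) := by
    have h := hreg.div hm one_ne_zero
    rw [div_one] at h
    refine h.congr' ?_
    filter_upwards [hdi.eventually_gt_atTop 0] with n hn
    exact div_div_div_cancel_right₀ hn.ne' _ _
  have hσk : ∀ᶠ n : ℕ in atTop, σ * ρ * ((d n : ℝ) - 3) ≤ (n : ℝ) - d n := by
    filter_upwards [hk.eventually_const_le (show σ * ρ < ρ by nlinarith),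
      hdi.eventually_gt_atTop 3] with n hn hn3
    exact (le_div_iff₀ (by linarith)).1 hn
  have hrate : Tendsto (fun n : ℕ => (n * log (ρ + 1) - (n - d n) * log ρ +
      (((n : ℝ) - d n) / ((d n : ℝ) - 3) + σ * ((d n : ℝ) - 3) * (γ - chooseRate ρ)) +
      (log 4 + log (d n))) / d n) atTop (𝓝 (chooseRate ρ + σ * (γ - chooseRate ρ))) := by
    have h := (((((tendsto_ambient_ratio hdi hreg).mul_const (log (ρ + 1))).sub
      (hreg.mul_const (log ρ))).add ((hk.mul hdi.inv_tendsto_atTop).add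
      ((hm.const_mul σ).mul_const (γ - chooseRate ρ)))).add
      ((hdi.inv_tendsto_atTop.const_mul (log 4)).add (tendsto_log_div hdi)))
    convert! h using 1
    · ext n
      simp only [Pi.inv_apply, div_eq_mul_inv]
      ring
    · rw [chooseRate]; simp
  have hexp := tendsto_exp_atBot.comp (hdi.atTop_mul_neg hσ hrate)
  refine tendsto_of_tendsto_of_tendsto_of_le_of_le' tendsto_const_nhds hexp ?_ ?_
  · filter_upwards [hd4, hab] with n hn ⟨h1, h2, h3, _⟩
    exact FF_nonneg n hn h1 h2 h3
  · filter_upwards [hd4, hab, hd, hσk] with n hn ⟨h1, h2, h3, h4⟩ hdn hσn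
    have hd0 : (d n : ℝ) ≠ 0 := by positivity
    simp only [Function.comp_apply]
    rw [mul_div_cancel₀ _ hd0]
    exact FF_le hρ hn hdn.2 hσ0.le hσ1.le hσn h1 h2 h3 h4

theorem tendsto_log_choose_lower (hρ : 0 < ρ)
    (hdi : Tendsto (fun n : ℕ => (d n : ℝ)) atTop atTop)
    (hreg : Tendsto (fun n : ℕ => ((n : ℝ) - (d n : ℝ)) / (d n : ℝ)) atTop (𝓝 ρ)) :
    Tendsto (fun n : ℕ => ((n : ℝ) * log n - d n * log (d n) - (n - d n) * log (n - d n) - 2 -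
      (log (d n) + log ((n : ℝ) - d n)) / 2) / d n) atTop (𝓝 (chooseRate ρ)) := by
  have hN := tendsto_ambient_ratio hdi hreg
  have hlogN := hN.log (by linarith)
  have hlogk := hreg.log hρ.ne'
  have hinv := hdi.inv_tendsto_atTop
  have h := (((hN.mul hlogN).sub (hreg.mul hlogk)).sub (hinv.const_mul 2)).sub
    ((tendsto_log_div hdi).add ((hlogk.mul hinv).div_const 2))
  have hlim : (ρ + 1) * log (ρ + 1) - ρ * log ρ - 2 * 0 - (0 + log ρ * 0 / 2) = chooseRate ρ := by
    rw [chooseRate]; ring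
  rw [hlim] at h
  refine h.congr' ?_
  filter_upwards [hdi.eventually_gt_atTop 0, hreg.eventually_const_lt hρ,
    eventually_gt_atTop 0] with n hn hk hn0
  have hk' : 0 < (n : ℝ) - d n := by
    rcases div_pos_iff.1 hk with h | h
    · exact h.1
    · linarith [h.2]
  have hn0' : (0 : ℝ) < n := by exact_mod_cast hn0
  rw [log_div hn0'.ne' hn.ne', log_div hk'.ne' hn.ne']
  simp only [Pi.inv_apply]
  field_simp
  ring

theorem tendsto_FF_atTop (hρ : 0 < ρ) (hd : ∀ᶠ n in atTop, 2 ≤ d n ∧ d n < n)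
    (hdi : Tendsto (fun n : ℕ => (d n : ℝ)) atTop atTop)
    (hreg : Tendsto (fun n : ℕ => ((n : ℝ) - (d n : ℝ)) / (d n : ℝ)) atTop (𝓝 ρ))
    {x ε : ℝ} (hε : 0 < ε)
    (hx : 0 < chooseRate ρ - (|x| + ε) ^ 2 / 2 + ρ * log (stdPhi x)) {a b : ℕ → ℝ}
    (hab : ∀ᶠ n in atTop, -1 ≤ a n ∧ a n ≤ x / √(d n) ∧ (x + ε) / √(d n) ≤ b n ∧ b n ≤ 1) :
    Tendsto (fun n => FF n (d n) (a n) (b n)) atTop atTop := by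
  have hd4 : ∀ᶠ n in atTop, 4 ≤ d n :=
    (hdi.eventually_ge_atTop 4).mono fun n hn => by exact_mod_cast hn
  have hinv := hdi.inv_tendsto_atTop
  have hcap : Tendsto (fun n => capCDF (d n) (x / √(d n))) atTop (𝓝 (stdPhi x)) :=
    (tendsto_capCDF x).comp (tendsto_natCast_atTop_iff.1 hdi)
  have hα : Tendsto (fun n => ((1 - 2 * (d n : ℝ)⁻¹ - (d n : ℝ)⁻¹ * (d n : ℝ)⁻¹) / 2) *
      (d n * log (1 + -(|x| + ε) ^ 2 / d n))) atTop (𝓝 (1 / 2 * -(|x| + ε) ^ 2)) := by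
    refine Tendsto.mul ?_ ((tendsto_mul_log_one_add_div_atTop _).comp hdi)
    have h := (((hinv.const_mul 2).const_sub 1).sub (hinv.mul hinv)).div_const 2
    simpa using h
  have hrate : Tendsto (fun n : ℕ => (((n : ℝ) * log n - d n * log (d n) -
      (n - d n) * log (n - d n) - 2 - (log (d n) + log ((n : ℝ) - d n)) / 2) +
      (log ε - log (d n) / 2) +
      ((d n : ℝ) ^ 2 - 2 * d n - 1) / 2 * log (1 - (|x| + ε) ^ 2 / d n) +
      ((n : ℝ) - d n) * log (capCDF (d n) (x / √(d n)))) / d n) atTop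
      (𝓝 (chooseRate ρ - (|x| + ε) ^ 2 / 2 + ρ * log (stdPhi x))) := by
    have h := (((tendsto_log_choose_lower hρ hdi hreg).add
      ((hinv.const_mul (log ε)).sub ((tendsto_log_div hdi).div_const 2))).add hα).add
      (hreg.mul (hcap.log (stdPhi_pos x).ne'))
    have hlim : chooseRate ρ + (log ε * 0 - 0 / 2) + 1 / 2 * -(|x| + ε) ^ 2 +
        ρ * log (stdPhi x) = chooseRate ρ - (|x| + ε) ^ 2 / 2 + ρ * log (stdPhi x) := by ring
    rw [hlim] at h
    refine h.congr' ?_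
    filter_upwards [hdi.eventually_gt_atTop 0] with n hn
    rw [neg_div, ← sub_eq_add_neg]
    simp only [Pi.inv_apply]
    field_simp
  refine tendsto_atTop_mono' _ ?_ (tendsto_exp_atTop.comp (hdi.atTop_mul_pos hx hrate))
  filter_upwards [hd4, hab, hd, hcap.eventually_const_lt (stdPhi_pos x),
    hdi.eventually_gt_atTop ((|x| + ε) ^ 2)] with n hn ⟨h1, h2, h3, h4⟩ hdn hP hw
  have hd0 : (d n : ℝ) ≠ 0 := by positivity
  refine le_trans ?_ (le_FF hn hε h1 h2 h3 h4 hw hdn.2 hP)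
  simp only [Function.comp_apply]
  rw [mul_div_cancel₀ _ hd0]
  refine exp_le_exp.2 ?_
  linarith [le_log_choose (show d n ≠ 0 by omega) hdn.2]

theorem eventually_perturbed_grho_pos {x : ℝ} (hx : 0 < grho ρ x) :
    ∀ᶠ ε in 𝓝[>] (0 : ℝ),
      0 < chooseRate ρ - (|x| + ε) ^ 2 / 2 + ρ * log (stdPhi x) := by
  have hc : Continuous fun ε : ℝ =>
      chooseRate ρ - (|x| + ε) ^ 2 / 2 + ρ * log (stdPhi x) := by fun_prop
  refine (hc.continuousAt.eventually_const_lt ?_).filter_mono nhdsWithin_le_nhds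
  simpa [grho_eq] using hx

end LinearRegime

/-- in the linear regime `(n-d)/d → ρ > 0`, the heights of the facets
concentrate in `[r_ℓ/√d, r_u/√d]` where `r_ℓ = inf{r : g_ρ(r) > 0}` and
`r_u = sup{r : g_ρ(r) > 0}`. -/
theorem facet_range_linear (d : ℕ → ℕ) (ρ : ℝ) (hρ : 0 < ρ)
    (hd : ∀ᶠ n in atTop, 2 ≤ d n ∧ d n < n)
    (hdi : Tendsto (fun n : ℕ => (d n : ℝ)) atTop atTop)
    (hreg : Tendsto (fun n : ℕ => ((n : ℝ) - (d n : ℝ)) / (d n : ℝ)) atTop (nhds ρ)) :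
    sInf {r : ℝ | 0 < grho ρ r} < sSup {r : ℝ | 0 < grho ρ r} ∧
    ∀ r : ℝ,
      (sInf {r : ℝ | 0 < grho ρ r} < r →
        Tendsto (fun n : ℕ => FF n (d n) (-1) (r / Real.sqrt (d n))) atTop atTop) ∧
      (r < sInf {r : ℝ | 0 < grho ρ r} →
        Tendsto (fun n : ℕ => FF n (d n) (-1) (r / Real.sqrt (d n))) atTop (nhds 0)) ∧
      (r < sSup {r : ℝ | 0 < grho ρ r} →
        Tendsto (fun n : ℕ => FF n (d n) (r / Real.sqrt (d n)) 1) atTop atTop) ∧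
      (sSup {r : ℝ | 0 < grho ρ r} < r →
        Tendsto (fun n : ℕ => FF n (d n) (r / Real.sqrt (d n)) 1) atTop (nhds 0)) := by
  refine ⟨sInf_lt_sSup_grho_pos hρ, fun r => ⟨fun hr => ?_, fun hr => ?_, fun hr => ?_,
    fun hr => ?_⟩⟩
  · obtain ⟨x, hx, hxr⟩ := exists_lt_of_csInf_lt (exists_grho_pos hρ) hr
    obtain ⟨ε, hε, hε0, hεr⟩ := ((eventually_perturbed_grho_pos hx).and
      (Ioo_mem_nhdsGT (sub_pos.2 hxr))).exists
    refine tendsto_FF_atTop hρ hd hdi hreg hε0 hε ?_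
    filter_upwards [eventually_div_sqrt_mem hdi x, eventually_div_sqrt_mem hdi r] with n h1 h2
    refine ⟨le_rfl, h1.1, ?_, h2.2⟩
    gcongr
    linarith
  · obtain ⟨t, hrt, ht⟩ := exists_between hr
    obtain ⟨hneg, hle⟩ := grho_neg_of_lt_sInf hρ ht
    refine tendsto_FF_zero hρ hd hdi hreg hneg ?_
    filter_upwards [eventually_div_sqrt_mem hdi r,
      (tendsto_div_sqrt_mul_sqrt hdi r).eventually_le_const hrt] with n h1 h2
    exact ⟨le_rfl, h1.1, h1.2, fun h hh => hle _
      ((mul_le_mul_of_nonneg_right hh.2 (Real.sqrt_nonneg _)).trans h2)⟩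
  · obtain ⟨x, hx, hxr⟩ := exists_lt_of_lt_csSup (exists_grho_pos hρ) hr
    obtain ⟨ε, hε, hε0⟩ := ((eventually_perturbed_grho_pos hx).and self_mem_nhdsWithin).exists
    refine tendsto_FF_atTop hρ hd hdi hreg hε0 hε ?_
    filter_upwards [eventually_div_sqrt_mem hdi (x + ε), eventually_div_sqrt_mem hdi r]
      with n h1 h2
    refine ⟨h2.1, ?_, h1.2, le_rfl⟩
    gcongr
  · obtain ⟨t, ht, htr⟩ := exists_between hr
    obtain ⟨hneg, hle⟩ := grho_neg_of_sSup_lt hρ ht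
    refine tendsto_FF_zero hρ hd hdi hreg hneg ?_
    filter_upwards [eventually_div_sqrt_mem hdi r,
      (tendsto_div_sqrt_mul_sqrt hdi r).eventually_const_le htr] with n h1 h2
    exact ⟨h1.1, h1.2, le_rfl, fun h hh => hle _
      (h2.trans (mul_le_mul_of_nonneg_right hh.1 (Real.sqrt_nonneg _)))⟩
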